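/- Let $s \in (0,1/2)$, $p \geq 1$, and let $\Omega \subset \mathbb{R}^d$ be a bounded Lipschitz domain. Suppose $w \in W^{s}_p(\Omega)$ (with $sp < 1$) is extended by zero outside $\Omega$. Then $\iint_{\Omega \times \Omega^c} \frac{|w(x)|^p}{|x-y|^{d+sp}}\,dx\,dy \leq C \int_\Omega \frac{|w(x)|^p}{\mathrm{dist}(x,\partial\Omega)^{sp}}\,dx \leq C' \|w\|^p_{W^s_p(\Omega)}$, where $C, C'$ depend only on $d, s, p, \Omega$. -/

import Mathlib

open MeasureTheory Set RealInnerProductSpace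

/-- A bounded Lipschitz domain: near every boundary point, `Ω` is, inside a small ball,
the strict hypograph of a Lipschitz function that is constant in a fixed unit direction. -/
def IsBddLipschitzDomain {d : ℕ} (Ω : Set (EuclideanSpace ℝ (Fin d))) : Prop :=
  IsOpen Ω ∧ Bornology.IsBounded Ω ∧ Ω.Nonempty ∧
  ∀ x ∈ frontier Ω, ∃ r > (0:ℝ), ∃ v : EuclideanSpace ℝ (Fin d), ‖v‖ = 1 ∧
    ∃ L : NNReal, ∃ f : EuclideanSpace ℝ (Fin d) → ℝ, LipschitzWith L f ∧
      (∀ (y : EuclideanSpace ℝ (Fin d)) (t : ℝ), f (y + t • v) = f y) ∧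
      ∀ y ∈ Metric.ball x r, (y ∈ Ω ↔ f y < ⟪y, v⟫)

section Helpers

set_option linter.unusedSectionVars false

variable {E : Type*} [NormedAddCommGroup E] [NormedSpace ℝ E] [MeasureSpace E] [BorelSpace E]
  [FiniteDimensional ℝ E] [(volume : Measure E).IsAddHaarMeasure]

theorem infDist_frontier_le {Ω : Set E} {x y : E} (hx : x ∈ Ω) (hy : y ∉ Ω) :
    Metric.infDist x (frontier Ω) ≤ dist x y := by
  have hc : IsPreconnected (segment ℝ x y) := (convex_segment x y).isPreconnected
  obtain ⟨z, hz, hzf⟩ : (segment ℝ x y ∩ frontier Ω).Nonempty := by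
    by_contra hne
    rw [not_nonempty_iff_eq_empty] at hne
    have h1 := hc.subset_left_of_subset_union (u := interior Ω) (v := (closure Ω)ᶜ)
      isOpen_interior isClosed_closure.isOpen_compl
      (disjoint_compl_right.mono_left (interior_subset.trans subset_closure))
      (by
        intro z hz
        by_contra hcon
        simp only [mem_union, not_or, mem_compl_iff, not_not] at hcon
        have : z ∈ segment ℝ x y ∩ frontier Ω := ⟨hz, hcon.2, hcon.1⟩
        rw [hne] at this
        exact this)
      ⟨x, left_mem_segment ℝ x y, by
        by_contra hcon
        have : x ∈ segment ℝ x y ∩ frontier Ω :=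
          ⟨left_mem_segment ℝ x y, subset_closure hx, hcon⟩
        rw [hne] at this
        exact this⟩
    exact hy (interior_subset (h1 (right_mem_segment ℝ x y)))
  calc _ ≤ dist x z := Metric.infDist_le_dist_of_mem hzf
    _ ≤ dist x y := by
      have := dist_add_dist_of_mem_segment hz
      have h2 := dist_nonneg (x := z) (y := y)
      linarith

theorem lintegral_scaled (r δ : ℝ) (hδ : 0 < δ) :
    ∫⁻ z : E, ENNReal.ofReal ((δ + ‖z‖) ^ (-r)) =
      ENNReal.ofReal (δ ^ ((Module.finrank ℝ E : ℝ) - r)) *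
        ∫⁻ z : E, ENNReal.ofReal ((1 + ‖z‖) ^ (-r)) := by
  have hm : Measurable (fun z : E => ENNReal.ofReal ((δ + ‖z‖) ^ (-r))) := by fun_prop
  have h := lintegral_map (μ := (volume : Measure E)) hm (measurable_const_smul δ)
  rw [Measure.map_addHaar_smul _ hδ.ne', lintegral_smul_measure] at h
  have h3 : ∀ a : E, ENNReal.ofReal ((δ + ‖δ • a‖) ^ (-r)) =
      ENNReal.ofReal (δ ^ (-r)) * ENNReal.ofReal ((1 + ‖a‖) ^ (-r)) := by
    intro a
    rw [← ENNReal.ofReal_mul (by positivity), ← Real.mul_rpow hδ.le (by positivity), norm_smul,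
      Real.norm_of_nonneg hδ.le]
    ring_nf
  simp_rw [h3] at h
  rw [lintegral_const_mul _ (by fun_prop)] at h
  rw [sub_eq_add_neg, Real.rpow_add hδ, Real.rpow_natCast, ENNReal.ofReal_mul (by positivity),
    mul_assoc, ← h, smul_eq_mul, ← mul_assoc, ← ENNReal.ofReal_mul (by positivity),
    abs_of_pos (by positivity), mul_inv_cancel₀ (by positivity)]
  simp

theorem tail_bound (r : ℝ) (hr : 0 ≤ r) (x : E) (δ : ℝ) (hδ : 0 < δ) (S : Set E)
    (hm : MeasurableSet S) (hS : ∀ y ∈ S, δ ≤ ‖x - y‖) :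
    ∫⁻ y in S, ENNReal.ofReal (‖x - y‖ ^ (-r)) ≤
      ENNReal.ofReal (2 ^ r * δ ^ ((Module.finrank ℝ E : ℝ) - r)) *
        ∫⁻ z : E, ENNReal.ofReal ((1 + ‖z‖) ^ (-r)) := by
  rw [ENNReal.ofReal_mul (by positivity), mul_assoc, ← lintegral_scaled r δ hδ]
  calc _ ≤ ∫⁻ y in S, ENNReal.ofReal (2 ^ r) * ENNReal.ofReal ((δ + ‖x - y‖) ^ (-r)) := by
        refine setLIntegral_mono' hm fun y hy => ?_
        have h1 := hS y hy
        rw [← ENNReal.ofReal_mul (by positivity)]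
        apply ENNReal.ofReal_le_ofReal
        have h2 : (2:ℝ) ^ r = (1/2) ^ (-r) := by
          rw [Real.rpow_neg (by norm_num), ← Real.inv_rpow (by norm_num)]; norm_num
        rw [h2, ← Real.mul_rpow (by norm_num) (by positivity)]
        apply Real.rpow_le_rpow_of_nonpos (by positivity) (by linarith) (by linarith)
    _ ≤ ∫⁻ y, ENNReal.ofReal (2 ^ r) * ENNReal.ofReal ((δ + ‖x - y‖) ^ (-r)) :=
        setLIntegral_le_lintegral _ _
    _ = _ := by
        rw [lintegral_const_mul _ (by fun_prop)]
        congr 1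
        exact lintegral_sub_left_eq_self (μ := (volume : Measure E))
          (fun z => ENNReal.ofReal ((δ + ‖z‖) ^ (-r))) x

theorem pow_ineq (p : ℝ) (hp : 1 ≤ p) (a b : ℝ) :
    ENNReal.ofReal (|a| ^ p) ≤ 2 ^ (p - 1) *
      (ENNReal.ofReal (|b| ^ p) + ENNReal.ofReal (|a - b| ^ p)) := by
  have h0 : 0 ≤ p := by linarith
  simp_rw [← ENNReal.ofReal_rpow_of_nonneg (abs_nonneg _) h0]
  refine le_trans ?_ (ENNReal.rpow_add_le_mul_rpow_add_rpow _ _ hp)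
  apply ENNReal.rpow_le_rpow _ h0
  rw [← ENNReal.ofReal_add (abs_nonneg _) (abs_nonneg _)]
  apply ENNReal.ofReal_le_ofReal
  have := abs_add_le b (a - b)
  simpa using this

/-- One layer. -/
theorem layer (p : ℝ) (hp : 1 ≤ p) (h : E → ℝ) (v : E) (hv : ‖v‖ = 1) (K : ℝ) (hK : 1 ≤ K)
    (hshift : ∀ (x : E) (t : ℝ), h (x + t • v) = h x + t)
    (R : ℝ) (hR : 0 < R) (M : ℕ) (D T : Set E) (hDm : MeasurableSet D) (hTm : MeasurableSet T)
    (hD : ∀ x ∈ D, R < h x ∧ h x ≤ 2 * R)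
    (hT : ∀ x ∈ D, ∀ j : ℕ, M ≤ j → j < 2 * M → ∀ z : E, ‖z‖ < R / K →
      x + (((j : ℝ) * R) • v + z) ∈ T)
    (w : E → ℝ) (hw : Measurable w) :
    (M : ENNReal) * volume (Metric.ball (0 : E) (R / K)) * ∫⁻ x in D, ENNReal.ofReal (|w x| ^ p)
      ≤ 2 ^ (p - 1) * (volume (Metric.ball (0 : E) (R / K)) * (∫⁻ y in T, ENNReal.ofReal (|w y| ^ p))
        + M * ∫⁻ x in D, ∫⁻ y in T ∩ Metric.closedBall x (2 * M * R),
            ENNReal.ofReal (|w x - w y| ^ p)) := by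
  set B := Metric.ball (0 : E) (R / K) with hB
  have hBm : MeasurableSet B := measurableSet_ball
  set g : E → ENNReal := fun x => ENNReal.ofReal (|w x| ^ p) with hg
  have hgm : Measurable g := by fun_prop
  have hGm : Measurable (fun q : E × E => ENNReal.ofReal (|w q.1 - w q.2| ^ p)) := by fun_prop
  -- the basic averaged inequality
  have h1 : ∑ j ∈ Finset.Ico M (2 * M), ∫⁻ z in B, ∫⁻ x in D, g x ≤
      ∑ j ∈ Finset.Ico M (2 * M), ∫⁻ z in B, ∫⁻ x in D, 2 ^ (p - 1) *
        (g (x + (((j : ℝ) * R) • v + z)) +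
          ENNReal.ofReal (|w x - w (x + (((j : ℝ) * R) • v + z))| ^ p)) := by
    refine Finset.sum_le_sum fun j _ => lintegral_mono fun z => lintegral_mono fun x => ?_
    exact pow_ineq p hp _ _
  have h2 : ∑ j ∈ Finset.Ico M (2 * M), ∫⁻ z in B, ∫⁻ x in D, g x =
      (M : ENNReal) * volume B * ∫⁻ x in D, g x := by
    simp only [Finset.sum_const, Nat.card_Ico, lintegral_const, Measure.restrict_apply_univ,
      nsmul_eq_mul]
    have : 2 * M - M = M := by omega
    rw [this]; ring
  have hterm1 : ∑ j ∈ Finset.Ico M (2 * M), ∫⁻ z in B, ∫⁻ x in D, g (x + (((j : ℝ) * R) • v + z))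
      ≤ volume B * ∫⁻ y in T, g y := by
    rw [← lintegral_finsetSum _ (by
      intro j _
      apply Measurable.lintegral_prod_right'
        (f := fun q : E × E => g (q.2 + (((j : ℝ) * R) • v + q.1)))
      fun_prop)]
    have : volume B * ∫⁻ y in T, g y = ∫⁻ z in B, ∫⁻ y in T, g y := by
      rw [lintegral_const, Measure.restrict_apply_univ, mul_comm]
    rw [this]
    refine setLIntegral_mono' hBm fun z hz => ?_
    have hz' : ‖z‖ < R / K := by simpa [hB] using hz
    set A : ℕ → Set E := fun j => (fun y => y - (((j : ℝ) * R) • v + z)) ⁻¹' D with hA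
    have hAm : ∀ j, MeasurableSet (A j) := fun j => hDm.preimage (by fun_prop)
    have e1 : ∀ j : ℕ, ∫⁻ x in D, g (x + (((j : ℝ) * R) • v + z)) = ∫⁻ y in A j, g y := by
      intro j
      rw [← lintegral_indicator hDm, ← lintegral_indicator (hAm j),
        ← lintegral_add_right_eq_self (μ := (volume : Measure E)) ((A j).indicator _)
          (((j : ℝ) * R) • v + z)]
      congr 1
      ext x
      have hiff : x + (((j : ℝ) * R) • v + z) ∈ A j ↔ x ∈ D := by
        simp only [hA, mem_preimage, add_sub_cancel_right]
      by_cases hxD : x ∈ D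
      · rw [indicator_of_mem hxD, indicator_of_mem (hiff.mpr hxD)]
      · rw [indicator_of_notMem hxD, indicator_of_notMem (fun hc => hxD (hiff.mp hc))]
    simp_rw [e1]
    rw [← lintegral_biUnion_finset _ (fun j _ => hAm j)]
    · refine lintegral_mono_set ?_
      intro y hy
      simp only [mem_iUnion, Finset.mem_Ico] at hy
      obtain ⟨j, hj, hy⟩ := hy
      have := hT _ hy j hj.1 hj.2 z hz'
      simpa using this
    · intro i _ j _ hij
      rw [Function.onFun, Set.disjoint_left]
      intro y hyi hyj
      apply hij
      have key : ∀ k : ℕ, h (y - (((k : ℝ) * R) • v + z)) = h (y - z) - k * R := by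
        intro k
        have := hshift (y - z) (-(k * R))
        rw [sub_eq_add_neg (h (y - z)), ← this]
        congr 1
        rw [neg_smul]; abel
      have a1 := hD _ hyi
      have a2 := hD _ hyj
      simp only [key] at a1 a2
      have b1 : (i : ℝ) < j + 1 := by
        by_contra hc; push Not at hc; nlinarith
      have b2 : (j : ℝ) < i + 1 := by
        by_contra hc; push Not at hc; nlinarith
      norm_cast at b1 b2
      omega
  have hterm2 : ∀ j ∈ Finset.Ico M (2 * M), ∫⁻ z in B, ∫⁻ x in D,
      ENNReal.ofReal (|w x - w (x + (((j : ℝ) * R) • v + z))| ^ p) ≤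
      ∫⁻ x in D, ∫⁻ y in T ∩ Metric.closedBall x (2 * M * R),
            ENNReal.ofReal (|w x - w y| ^ p) := by
    intro j hj
    rw [lintegral_lintegral_swap (by
      apply Measurable.aemeasurable
      unfold Function.uncurry
      fun_prop)]
    refine setLIntegral_mono' hDm fun x hx => ?_
    rw [← lintegral_indicator hBm, ← lintegral_indicator (hTm.inter measurableSet_closedBall),
      ← lintegral_add_left_eq_self (μ := (volume : Measure E))
        ((T ∩ Metric.closedBall x (2 * M * R)).indicator _) (x + ((j : ℝ) * R) • v)]
    refine lintegral_mono fun z => ?_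
    by_cases hz : z ∈ B
    · have hz' : ‖z‖ < R / K := by simpa [hB] using hz
      rw [Finset.mem_Ico] at hj
      have hmem := hT x hx j hj.1 hj.2 z hz'
      rw [← add_assoc] at hmem
      have hcb : x + ((j : ℝ) * R) • v + z ∈ Metric.closedBall x (2 * M * R) := by
        rw [Metric.mem_closedBall, dist_eq_norm]
        have : x + ((j : ℝ) * R) • v + z - x = ((j : ℝ) * R) • v + z := by abel
        rw [this]
        refine (norm_add_le _ _).trans ?_
        rw [norm_smul, hv, Real.norm_of_nonneg (by positivity)]
        have : R / K ≤ R := div_le_self hR.le hK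
        have hj2 : (j : ℝ) + 1 ≤ 2 * M := by exact_mod_cast hj.2
        nlinarith
      rw [indicator_of_mem hz, indicator_of_mem (mem_inter hmem hcb), add_assoc]
    · rw [indicator_of_notMem hz]; exact zero_le
  calc _ ≤ _ := h2 ▸ h1
    _ = 2 ^ (p - 1) * ((∑ j ∈ Finset.Ico M (2 * M), ∫⁻ z in B, ∫⁻ x in D,
          g (x + (((j : ℝ) * R) • v + z))) + ∑ j ∈ Finset.Ico M (2 * M), ∫⁻ z in B, ∫⁻ x in D,
          ENNReal.ofReal (|w x - w (x + (((j : ℝ) * R) • v + z))| ^ p)) := by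
        rw [← Finset.sum_add_distrib, Finset.mul_sum]
        refine Finset.sum_congr rfl fun j _ => ?_
        rw [← lintegral_add_left, ← lintegral_const_mul]
        · refine lintegral_congr fun z => ?_
          rw [← lintegral_add_left (by fun_prop), ← lintegral_const_mul _ (by fun_prop)]
        · apply Measurable.add
          · apply Measurable.lintegral_prod_right'
              (f := fun q : E × E => g (q.2 + (((j : ℝ) * R) • v + q.1)))
            fun_prop
          · apply Measurable.lintegral_prod_right'
              (f := fun q : E × E => ENNReal.ofReal (|w q.2 - w (q.2 + (((j : ℝ) * R) • v + q.1))| ^ p))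
            fun_prop
        · apply Measurable.lintegral_prod_right'
              (f := fun q : E × E => g (q.2 + (((j : ℝ) * R) • v + q.1)))
          fun_prop
    _ ≤ _ := by
        gcongr
        refine (Finset.sum_le_sum hterm2).trans ?_
        simp only [Finset.sum_const, Nat.card_Ico, nsmul_eq_mul]
        have : 2 * M - M = M := by omega
        rw [this]

theorem layer2 [Nontrivial E] (p σ : ℝ) (hp : 1 ≤ p) (hσ : 0 < σ) (h : E → ℝ) (v : E)
    (hv : ‖v‖ = 1) (K : ℝ) (hK : 1 ≤ K)
    (hshift : ∀ (x : E) (t : ℝ), h (x + t • v) = h x + t)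
    (R : ℝ) (hR : 0 < R) (M : ℕ) (hM : 1 ≤ M) (D T : Set E) (hDm : MeasurableSet D)
    (hTm : MeasurableSet T)
    (hD : ∀ x ∈ D, R < h x ∧ h x ≤ 2 * R)
    (hT : ∀ x ∈ D, ∀ j : ℕ, M ≤ j → j < 2 * M → ∀ z : E, ‖z‖ < R / K →
      x + (((j : ℝ) * R) • v + z) ∈ T)
    (w : E → ℝ) (hw : Measurable w) :
    ∫⁻ x in D, ENNReal.ofReal (|w x| ^ p)
      ≤ 2 ^ (p - 1) * ((M : ENNReal)⁻¹ * (∫⁻ y in T, ENNReal.ofReal (|w y| ^ p))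
        + ENNReal.ofReal ((2 * M) ^ ((Module.finrank ℝ E : ℝ) + σ) * K ^ (Module.finrank ℝ E) /
            (volume (Metric.ball (0 : E) 1)).toReal * R ^ σ) *
          ∫⁻ x in D, ∫⁻ y in T,
            ENNReal.ofReal (|w x - w y| ^ p / ‖x - y‖ ^ ((Module.finrank ℝ E : ℝ) + σ))) := by
  set n := Module.finrank ℝ E with hn
  set V := (volume (Metric.ball (0 : E) 1)).toReal with hV
  have hMr : (1 : ℝ) ≤ M := by exact_mod_cast hM
  have hV0 : 0 < V := ENNReal.toReal_pos (Metric.measure_ball_pos _ _ one_pos).ne'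
    measure_ball_lt_top.ne
  have hK0 : 0 < K := by linarith
  have hball : volume (Metric.ball (0 : E) (R / K)) = ENNReal.ofReal ((R / K) ^ n * V) := by
    rw [Measure.addHaar_ball _ _ (by positivity), ENNReal.ofReal_mul (by positivity), hV,
      ENNReal.ofReal_toReal measure_ball_lt_top.ne]
  have hmain := layer p hp h v hv K hK hshift R hR M D T hDm hTm hD hT w hw
  set b := volume (Metric.ball (0 : E) (R / K)) with hb
  have hb0 : b ≠ 0 := (Metric.measure_ball_pos _ _ (by positivity)).ne'
  have hbt : b ≠ ⊤ := measure_ball_lt_top.ne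
  have hM0 : (M : ENNReal) ≠ 0 := by exact_mod_cast (by omega : M ≠ 0)
  have hMt : (M : ENNReal) ≠ ⊤ := ENNReal.natCast_ne_top M
  have hZ : ∫⁻ x in D, ∫⁻ y in T ∩ Metric.closedBall x (2 * M * R),
            ENNReal.ofReal (|w x - w y| ^ p) ≤
      ENNReal.ofReal ((2 * M * R) ^ ((n : ℝ) + σ)) * ∫⁻ x in D, ∫⁻ y in T,
            ENNReal.ofReal (|w x - w y| ^ p / ‖x - y‖ ^ ((n : ℝ) + σ)) := by
    rw [← lintegral_const_mul' _ _ ENNReal.ofReal_ne_top]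
    refine lintegral_mono fun x => ?_
    rw [← lintegral_const_mul' _ _ ENNReal.ofReal_ne_top]
    refine (setLIntegral_mono' (hTm.inter measurableSet_closedBall) fun y hy => ?_).trans
      (lintegral_mono_set inter_subset_left)
    rw [← ENNReal.ofReal_mul (by positivity)]
    apply ENNReal.ofReal_le_ofReal
    by_cases hxy : x = y
    · subst hxy
      simp [Real.zero_rpow (by linarith : p ≠ 0)]
    · have hpos : 0 < ‖x - y‖ := norm_pos_iff.mpr (sub_ne_zero.mpr hxy)
      have hle : ‖x - y‖ ≤ 2 * M * R := by
        have := hy.2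
        rwa [Metric.mem_closedBall, dist_comm, dist_eq_norm] at this
      rw [mul_div_assoc', le_div_iff₀ (by positivity), mul_comm]
      gcongr
  have hconst : b * ENNReal.ofReal ((2 * M) ^ ((n : ℝ) + σ) * K ^ n / V * R ^ σ) =
      ENNReal.ofReal ((2 * M * R) ^ ((n : ℝ) + σ)) := by
    rw [hball, ← ENNReal.ofReal_mul (by positivity)]
    congr 1
    rw [Real.mul_rpow (by positivity) hR.le, Real.rpow_add hR, Real.rpow_natCast, div_pow]
    field_simp
  set X := ∫⁻ x in D, ENNReal.ofReal (|w x| ^ p)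
  set Y := ∫⁻ x in T, ENNReal.ofReal (|w x| ^ p)
  set Z := ∫⁻ x in D, ∫⁻ y in T,
            ENNReal.ofReal (|w x - w y| ^ p / ‖x - y‖ ^ ((n : ℝ) + σ))
  rw [← ENNReal.mul_le_mul_iff_right (mul_ne_zero hM0 hb0) (ENNReal.mul_ne_top hMt hbt)]
  refine hmain.trans ?_
  refine (mul_le_mul_right (add_le_add_right (mul_le_mul_right hZ _) _) _).trans (le_of_eq ?_)
  rw [← hconst]
  have : (M : ENNReal) * (M : ENNReal)⁻¹ = 1 := ENNReal.mul_inv_cancel hM0 hMt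
  calc _ = 2 ^ (p - 1) * (((M : ENNReal) * (M : ENNReal)⁻¹) * (b * Y) + M * (b * ENNReal.ofReal ((2 * M) ^ ((n : ℝ) + σ) * K ^ n / V * R ^ σ) * Z)) := by
        rw [this, one_mul]
    _ = _ := by ring

theorem layer3 [Nontrivial E] (p σ : ℝ) (hp : 1 ≤ p) (hσ : 0 < σ) (h : E → ℝ) (v : E)
    (hv : ‖v‖ = 1) (K : ℝ) (hK : 1 ≤ K)
    (hshift : ∀ (x : E) (t : ℝ), h (x + t • v) = h x + t)
    (R : ℝ) (hR : 0 < R) (M : ℕ) (hM : 1 ≤ M) (D T : Set E) (hDm : MeasurableSet D)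
    (hTm : MeasurableSet T)
    (hD : ∀ x ∈ D, R < h x ∧ h x ≤ 2 * R)
    (hT : ∀ x ∈ D, ∀ j : ℕ, M ≤ j → j < 2 * M → ∀ z : E, ‖z‖ < R / K →
      x + (((j : ℝ) * R) • v + z) ∈ T)
    (w : E → ℝ) (hw : Measurable w) (W : E → ENNReal) (hW : Measurable W)
    (β Θ B1 : ENNReal) (hβ : ∀ x ∈ D, W x ≤ β)
    (hβT : ∀ y ∈ T, β ≤ Θ * W y) (hB1 : β * ENNReal.ofReal (R ^ σ) ≤ B1) :
    ∫⁻ x in D, ENNReal.ofReal (|w x| ^ p) * W x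
      ≤ 2 ^ (p - 1) * ((M : ENNReal)⁻¹ * (Θ * ∫⁻ y in T, ENNReal.ofReal (|w y| ^ p) * W y)
        + (ENNReal.ofReal ((2 * M) ^ ((Module.finrank ℝ E : ℝ) + σ) * K ^ (Module.finrank ℝ E) /
            (volume (Metric.ball (0 : E) 1)).toReal) * B1) *
          ∫⁻ x in D, ∫⁻ y in T,
            ENNReal.ofReal (|w x - w y| ^ p / ‖x - y‖ ^ ((Module.finrank ℝ E : ℝ) + σ))) := by
  have hl := layer2 p σ hp hσ h v hv K hK hshift R hR M hM D T hDm hTm hD hT w hw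
  have hR' : 0 ≤ R ^ σ := by positivity
  rw [ENNReal.ofReal_mul' hR'] at hl
  set c0 := ENNReal.ofReal ((2 * M) ^ ((Module.finrank ℝ E : ℝ) + σ) * K ^ (Module.finrank ℝ E) /
            (volume (Metric.ball (0 : E) 1)).toReal)
  set Z := ∫⁻ x in D, ∫⁻ y in T,
            ENNReal.ofReal (|w x - w y| ^ p / ‖x - y‖ ^ ((Module.finrank ℝ E : ℝ) + σ))
  have h1 : ∫⁻ x in D, ENNReal.ofReal (|w x| ^ p) * W x ≤
      β * ∫⁻ x in D, ENNReal.ofReal (|w x| ^ p) := by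
    rw [← lintegral_const_mul _ (by fun_prop)]
    refine setLIntegral_mono' hDm fun x hx => ?_
    rw [mul_comm]
    exact mul_le_mul_left (hβ x hx) _
  have h2 : β * ∫⁻ y in T, ENNReal.ofReal (|w y| ^ p) ≤
      Θ * ∫⁻ y in T, ENNReal.ofReal (|w y| ^ p) * W y := by
    rw [← lintegral_const_mul _ (by fun_prop), ← lintegral_const_mul _ (by fun_prop)]
    refine setLIntegral_mono' hTm fun x hx => ?_
    calc _ ≤ Θ * W x * ENNReal.ofReal (|w x| ^ p) := mul_le_mul_left (hβT x hx) _
      _ = _ := by ring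
  calc _ ≤ _ := h1.trans (mul_le_mul_right hl _)
    _ = 2 ^ (p - 1) * ((M : ENNReal)⁻¹ * (β * ∫⁻ y in T, ENNReal.ofReal (|w y| ^ p)) +
      (c0 * (β * ENNReal.ofReal (R ^ σ))) * Z) := by ring
    _ ≤ _ := by gcongr
theorem exists_M (σ c ε : ℝ) (hσ : σ < 1) (hε : 0 < ε) :
    ∃ M : ℕ, 1 ≤ M ∧ c * ((M : ℝ) ^ σ / M) ≤ ε := by
  have h1 : Filter.Tendsto (fun M : ℕ => c * ((M : ℝ) ^ (-(1 - σ)))) Filter.atTop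
      (nhds (c * 0)) :=
    ((tendsto_rpow_neg_atTop (by linarith : 0 < 1 - σ)).comp
      tendsto_natCast_atTop_atTop).const_mul c
  rw [mul_zero] at h1
  obtain ⟨M, hM, hM1⟩ := ((h1.eventually_lt_const hε).and (Filter.eventually_ge_atTop 1)).exists
  refine ⟨M, hM1, ?_⟩
  have hM0 : (0 : ℝ) < M := by exact_mod_cast hM1
  have : (M : ℝ) ^ σ / M = (M : ℝ) ^ (-(1 - σ)) := by
    rw [neg_sub, Real.rpow_sub hM0, Real.rpow_one]
  rw [this]
  exact hM.le

/-- The regularised weight. -/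
noncomputable def wt (Ω : Set E) (σ η : ℝ) (x : E) : ENNReal :=
  ENNReal.ofReal ((max (Metric.infDist x (frontier Ω)) η) ^ (-σ))

theorem wt_measurable (Ω : Set E) (σ η : ℝ) : Measurable (wt Ω σ η) := by
  unfold wt
  have : Measurable fun x : E => Metric.infDist x (frontier Ω) :=
    (Metric.continuous_infDist_pt _).measurable
  fun_prop

theorem wt_le (Ω : Set E) (σ η a : ℝ) (hσ : 0 < σ) (ha : 0 < a) (x : E)
    (hx : a ≤ Metric.infDist x (frontier Ω)) : wt Ω σ η x ≤ ENNReal.ofReal (a ^ (-σ)) := by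
  apply ENNReal.ofReal_le_ofReal
  exact Real.rpow_le_rpow_of_nonpos ha (hx.trans (le_max_left _ _)) (by linarith)

theorem local_bd [Nontrivial E] (Ω : Set E) (hΩ : IsOpen Ω) (hne : (frontier Ω).Nonempty)
    (p σ : ℝ) (hp : 1 ≤ p) (hσ : 0 < σ)
    (hσ1 : σ < 1) (x0 : E) (r : ℝ) (hr : 0 < r) (h : E → ℝ) (v : E) (hv : ‖v‖ = 1) (K : ℝ)
    (hK : 1 ≤ K) (hshift : ∀ (x : E) (t : ℝ), h (x + t • v) = h x + t)
    (hLip : ∀ x y, h x ≤ h y + K * ‖x - y‖) (hmeas : Measurable h)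
    (hmem : ∀ y ∈ Metric.ball x0 r, (y ∈ Ω ↔ 0 < h y)) (ε : ℝ) (hε : 0 < ε) :
    ∃ C : ENNReal, C ≠ ⊤ ∧ ∀ w : E → ℝ, Measurable w → ∀ η : ℝ, 0 < η →
      ∫⁻ x in Ω ∩ Metric.ball x0 (r / 4), ENNReal.ofReal (|w x| ^ p) * wt Ω σ η x ≤
        ENNReal.ofReal ε * (∫⁻ x in Ω, ENNReal.ofReal (|w x| ^ p) * wt Ω σ η x) +
        C * ((∫⁻ x in Ω, ENNReal.ofReal (|w x| ^ p)) + ∫⁻ x in Ω, ∫⁻ y in Ω,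
          ENNReal.ofReal (|w x - w y| ^ p / ‖x - y‖ ^ ((Module.finrank ℝ E : ℝ) + σ))) := by
  have hK0 : 0 < K := by linarith
  obtain ⟨M, hM, hMε⟩ := exists_M σ (2 ^ (p - 1) * 2 * (4 * K) ^ σ) ε hσ1 hε
  have hMr : (1 : ℝ) ≤ M := by exact_mod_cast hM
  set δ : E → ℝ := fun x => Metric.infDist x (frontier Ω) with hδ
  have hδm : Measurable δ := (Metric.continuous_infDist_pt _).measurable
  set η0 := r / (16 * M) with hη0
  have hη0p : 0 < η0 := by positivity
  have hη0M : M * η0 = r / 16 := by rw [hη0]; field_simp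
  have hη0r : η0 ≤ r / 16 := by nlinarith
  -- lower bound on the distance
  have hlow : ∀ x ∈ Metric.ball x0 (r / 4), min (h x) η0 ≤ K * δ x := by
    intro x hx
    rw [Metric.mem_ball] at hx
    rw [mul_comm, ← div_le_iff₀ hK0]
    refine (Metric.le_infDist hne).mpr fun z hz => ?_
    rw [div_le_iff₀ hK0]
    by_cases hzb : z ∈ Metric.ball x0 r
    · have hzΩ : z ∉ Ω := fun hc => by
        have := hΩ.inter_frontier_eq
        exact (this ▸ (⟨hc, hz⟩ : z ∈ Ω ∩ frontier Ω) : z ∈ (∅ : Set E))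
      rw [hmem z hzb, not_lt] at hzΩ
      refine (min_le_left _ _).trans ?_
      have := hLip x z
      rw [dist_eq_norm]
      linarith
    · refine (min_le_right _ _).trans ?_
      rw [Metric.mem_ball, not_lt] at hzb
      have h3 := dist_triangle z x x0
      rw [dist_comm z x] at h3
      have : r / 16 ≤ dist x z := by linarith
      have h4 : dist x z ≤ dist x z * K := le_mul_of_one_le_right dist_nonneg hK
      linarith
  set Θ : ℝ := (4 * M * K) ^ σ with hΘ
  set c0 : ENNReal := ENNReal.ofReal ((2 * M) ^ ((Module.finrank ℝ E : ℝ) + σ) *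
    K ^ (Module.finrank ℝ E) / (volume (Metric.ball (0 : E) 1)).toReal) *
      ENNReal.ofReal (K ^ σ) with hc0
  set C1 : ENNReal := ENNReal.ofReal ((η0 / K) ^ (-σ)) with hC1
  have h2top : (2 : ENNReal) ^ (p - 1) ≠ ⊤ := by
    apply ENNReal.rpow_ne_top_of_nonneg (by linarith) (by norm_num)
  refine ⟨2 ^ (p - 1) * c0 + C1, ?_, ?_⟩
  · exact ENNReal.add_ne_top.mpr ⟨ENNReal.mul_ne_top h2top
      (ENNReal.mul_ne_top ENNReal.ofReal_ne_top ENNReal.ofReal_ne_top), ENNReal.ofReal_ne_top⟩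
  intro w hw η hη
  set g : E → ENNReal := fun x => ENNReal.ofReal (|w x| ^ p) with hg
  have hgm : Measurable g := by fun_prop
  set W := wt Ω σ η with hW
  have hWm : Measurable W := wt_measurable Ω σ η
  set F : E → E → ENNReal := fun x y =>
    ENNReal.ofReal (|w x - w y| ^ p / ‖x - y‖ ^ ((Module.finrank ℝ E : ℝ) + σ)) with hF
  set D : ℤ → Set E := fun k => (Ω ∩ Metric.ball x0 (r / 4) ∩ {x | h x ≤ η0}) ∩
    h ⁻¹' (Ioc ((2 : ℝ) ^ k) (2 ^ (k + 1))) with hD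
  set U : ℤ → Set E := fun k => (Ω ∩ {y | δ y ≤ h y}) ∩
    h ⁻¹' (Ioc ((M : ℝ) * (2 : ℝ) ^ k) (M * 2 ^ (k + 1))) with hU
  have hDm : ∀ k, MeasurableSet (D k) := fun k =>
    ((hΩ.measurableSet.inter measurableSet_ball).inter (measurableSet_le hmeas measurable_const)).inter
      (hmeas measurableSet_Ioc)
  have hUm : ∀ k, MeasurableSet (U k) := fun k =>
    (hΩ.measurableSet.inter (measurableSet_le hδm hmeas)).inter (hmeas measurableSet_Ioc)
  have hmono : Monotone (fun k : ℤ => (2 : ℝ) ^ k) := zpow_right_mono₀ (by norm_num)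
  have hDd : Pairwise (Function.onFun Disjoint D) := by
    intro i j hij
    have := hmono.pairwise_disjoint_on_Ioc_succ hij
    exact (this.preimage h).mono inter_subset_right inter_subset_right
  have hUd : Pairwise (Function.onFun Disjoint U) := by
    intro i j hij
    have := (hmono.const_mul (by positivity : (0 : ℝ) ≤ M)).pairwise_disjoint_on_Ioc_succ hij
    exact (this.preimage h).mono inter_subset_right inter_subset_right
  -- the layer estimate
  have hlayer : ∀ k : ℤ, ∫⁻ x in D k, g x * W x ≤
      2 ^ (p - 1) * ((M : ENNReal)⁻¹ * (ENNReal.ofReal Θ * ∫⁻ y in U k ∪ U (k + 1), g y * W y) +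
        c0 * ∫⁻ x in D k, ∫⁻ y in U k ∪ U (k + 1), F x y) := by
    intro k
    have hR : (0 : ℝ) < 2 ^ k := by positivity
    have h2k : (2 : ℝ) ^ (k + 1) = 2 * 2 ^ k := by rw [zpow_add_one₀ (by norm_num)]; ring
    have h2k2 : (2 : ℝ) ^ (k + 1 + 1) = 4 * 2 ^ k := by
      rw [zpow_add_one₀ (by norm_num), h2k]; ring
    set R : ℝ := 2 ^ k with hRdef
    have hUU : ∀ y ∈ U k ∪ U (k + 1), δ y ≤ 4 * M * R := by
      intro y hy
      rcases hy with hy | hy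
      · have a := hy.1.2
        have b := hy.2.2
        rw [h2k] at b
        simp only [mem_ofPred_eq] at a
        nlinarith
      · have a := hy.1.2
        have b := hy.2.2
        rw [h2k2] at b
        simp only [mem_ofPred_eq] at a
        nlinarith
    refine layer3 p σ hp hσ h v hv K hK hshift R hR M hM (D k) (U k ∪ U (k + 1)) (hDm k)
      ((hUm k).union (hUm _)) ?_ ?_ w hw W hWm (ENNReal.ofReal ((max (R / K) η) ^ (-σ)))
      (ENNReal.ofReal Θ) (ENNReal.ofReal (K ^ σ)) ?_ ?_ ?_
    · intro x hx
      have := hx.2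
      rw [mem_preimage, h2k] at this
      exact this
    · intro x hx j hj1 hj2 z hz
      have hx1 : R < h x := hx.2.1
      have hx2 : h x ≤ 2 * R := h2k ▸ hx.2.2
      have hxη : h x ≤ η0 := hx.1.2
      have hxb : dist x x0 < r / 4 := hx.1.1.2
      have hj1' : (M : ℝ) ≤ j := by exact_mod_cast hj1
      have hj2' : (j : ℝ) + 1 ≤ 2 * M := by exact_mod_cast hj2
      have hzK : K * ‖z‖ < R := by rwa [lt_div_iff₀ hK0, mul_comm] at hz
      have hzR : ‖z‖ < R := lt_of_le_of_lt (le_mul_of_one_le_left (norm_nonneg _) hK) hzK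
      set y := x + (((j : ℝ) * R) • v + z) with hy
      have hhy : h y = h (x + z) + j * R := by
        rw [← hshift, hy]; congr 1; abel
      have hl1 := hLip x (x + z)
      have hl2 := hLip (x + z) x
      have n1 : ‖x - (x + z)‖ = ‖z‖ := by rw [sub_add_cancel_left, norm_neg]
      have n2 : ‖x + z - x‖ = ‖z‖ := by rw [add_sub_cancel_left]
      rw [n1] at hl1
      rw [n2] at hl2
      have hjR : M * R ≤ j * R := mul_le_mul_of_nonneg_right hj1' hR.le
      have hjR2 : (j + 1) * R ≤ 2 * M * R := mul_le_mul_of_nonneg_right hj2' hR.le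
      have hRM : R ≤ M * R := le_mul_of_one_le_left hR.le hMr
      have hy1 : M * R < h y := by linarith
      have hy2 : h y ≤ 4 * (M * R) := by linarith
      have hMRη : M * R ≤ r / 16 := by
        rw [← hη0M]; exact mul_le_mul_of_nonneg_left (by linarith) (by linarith)
      have hyx : dist y x0 ≤ dist x x0 + 2 * (M * R) := by
        have e : dist y x ≤ 2 * (M * R) := by
          rw [dist_eq_norm, hy, add_sub_cancel_left]
          refine (norm_add_le _ _).trans ?_
          rw [norm_smul, hv, Real.norm_of_nonneg (by positivity)]
          linarith
        have := dist_triangle y x x0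
        linarith
      have hyb : y ∈ Metric.ball x0 r := by rw [Metric.mem_ball]; linarith
      have hyΩ : y ∈ Ω := (hmem y hyb).mpr (lt_of_le_of_lt (by positivity) hy1)
      have hyδ : δ y ≤ h y := by
        have hpos : 0 < h y := lt_of_le_of_lt (by positivity) hy1
        have hd : dist y (y + (-h y) • v) = h y := by
          rw [dist_eq_norm, sub_add_cancel_left, norm_neg, norm_smul, hv, norm_neg,
            Real.norm_of_nonneg hpos.le, mul_one]
        have hnot : y + (-h y) • v ∉ Ω := by
          rw [hmem, hshift]
          · simp
          · rw [Metric.mem_ball]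
            have := dist_triangle (y + (-h y) • v) y x0
            rw [dist_comm _ y, hd] at this
            linarith
        exact hd ▸ infDist_frontier_le hyΩ hnot
      by_cases hc : h y ≤ M * (2 * R)
      · left
        refine ⟨⟨hyΩ, hyδ⟩, hy1, ?_⟩
        rw [h2k]; exact hc
      · right
        refine ⟨⟨hyΩ, hyδ⟩, ?_, ?_⟩
        · rw [h2k]; linarith
        · rw [h2k2]; linarith
    · intro x hx
      have hx1 : R < h x := hx.2.1
      have hxη : h x ≤ η0 := hx.1.2
      have h3 := hlow x hx.1.1.2
      rw [min_eq_left hxη] at h3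
      apply ENNReal.ofReal_le_ofReal
      apply Real.rpow_le_rpow_of_nonpos (by positivity) _ (by linarith)
      apply max_le_max_right
      rw [div_le_iff₀ hK0, mul_comm]
      exact hx1.le.trans h3
    · intro y hy
      have hyδ := hUU y hy
      rw [hW, wt, ← ENNReal.ofReal_mul (by positivity)]
      apply ENNReal.ofReal_le_ofReal
      have e1 : Θ = (1 / (4 * M * K)) ^ (-σ) := by
        rw [hΘ, one_div, Real.inv_rpow (by positivity), Real.rpow_neg (by positivity), inv_inv]
      rw [e1, ← Real.mul_rpow (by positivity) (by positivity)]
      apply Real.rpow_le_rpow_of_nonpos (by positivity) _ (by linarith)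
      rw [one_div, inv_mul_le_iff₀ (by positivity)]
      have q1 : 1 ≤ 4 * (M : ℝ) * K := by nlinarith
      apply max_le
      · calc δ y ≤ 4 * M * R := hyδ
          _ = 4 * M * K * (R / K) := by field_simp
          _ ≤ _ := by gcongr; exact le_max_left _ _
      · calc η ≤ max (R / K) η := le_max_right _ _
          _ ≤ _ := le_mul_of_one_le_left (by positivity) q1
    · rw [← ENNReal.ofReal_mul (by positivity)]
      apply ENNReal.ofReal_le_ofReal
      calc _ ≤ (R / K) ^ (-σ) * R ^ σ := by
            refine mul_le_mul_of_nonneg_right ?_ (by positivity)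
            exact Real.rpow_le_rpow_of_nonpos (by positivity) (le_max_left _ _) (by linarith)
        _ = K ^ σ := by
            rw [Real.rpow_neg (by positivity), Real.div_rpow hR.le hK0.le]
            field_simp
        _ ≤ _ := le_rfl
  have hcover : Ω ∩ Metric.ball x0 (r / 4) ⊆ (⋃ k, D k) ∪ {x | x ∈ Ω ∧ η0 / K ≤ δ x} := by
    intro x hx
    by_cases hc : h x ≤ η0
    · left
      have hpos : 0 < h x := (hmem x (Metric.ball_subset_ball (by linarith) hx.2)).mp hx.1
      obtain ⟨k, hk⟩ := exists_mem_Ioc_zpow hpos (by norm_num : (1 : ℝ) < 2)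
      exact mem_iUnion.mpr ⟨k, ⟨hx, hc⟩, hk⟩
    · right
      refine ⟨hx.1, ?_⟩
      have := hlow x hx.2
      rw [min_eq_right (not_le.mp hc).le] at this
      rw [div_le_iff₀ hK0, mul_comm]
      exact this
  set I := ∫⁻ x in Ω, g x * W x with hI
  set S := ∫⁻ x in Ω, ∫⁻ y in Ω, F x y with hS
  have hUsum : ∑' k, ∫⁻ y in U k, g y * W y ≤ I := by
    rw [← lintegral_iUnion hUm hUd]
    exact lintegral_mono_set (iUnion_subset fun k y hy => hy.1.1)
  have hUsum' : ∑' k, ∫⁻ y in U (k + 1), g y * W y ≤ I := by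
    refine le_trans (le_of_eq ?_) hUsum
    exact (Equiv.addRight (1 : ℤ)).tsum_eq (fun k => ∫⁻ y in U k, g y * W y)
  have hTsum : ∑' k, ∫⁻ y in U k ∪ U (k + 1), g y * W y ≤ 2 * I := by
    calc _ ≤ ∑' k, ((∫⁻ y in U k, g y * W y) + ∫⁻ y in U (k + 1), g y * W y) :=
          ENNReal.tsum_le_tsum fun k => lintegral_union_le _ _ _
      _ ≤ I + I := by rw [ENNReal.tsum_add]; exact add_le_add hUsum hUsum'
      _ = _ := by ring
  have hSsum : ∑' k, ∫⁻ x in D k, ∫⁻ y in U k ∪ U (k + 1), F x y ≤ S := by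
    calc _ ≤ ∑' k, ∫⁻ x in D k, ∫⁻ y in Ω, F x y := by
          refine ENNReal.tsum_le_tsum fun k => lintegral_mono fun x => lintegral_mono_set ?_
          exact union_subset (fun y hy => hy.1.1) (fun y hy => hy.1.1)
      _ = _ := (lintegral_iUnion hDm hDd _).symm
      _ ≤ _ := lintegral_mono_set (iUnion_subset fun k y hy => hy.1.1.1)
  have hDsum : ∫⁻ x in ⋃ k, D k, g x * W x ≤ ENNReal.ofReal ε * I + 2 ^ (p - 1) * c0 * S := by
    calc _ = ∑' k, ∫⁻ x in D k, g x * W x := lintegral_iUnion hDm hDd _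
      _ ≤ _ := ENNReal.tsum_le_tsum hlayer
      _ = 2 ^ (p - 1) * ((M : ENNReal)⁻¹ * (ENNReal.ofReal Θ *
            ∑' k, ∫⁻ y in U k ∪ U (k + 1), g y * W y) +
          c0 * ∑' k, ∫⁻ x in D k, ∫⁻ y in U k ∪ U (k + 1), F x y) := by
        rw [ENNReal.tsum_mul_left, ENNReal.tsum_add, ENNReal.tsum_mul_left, ENNReal.tsum_mul_left,
          ENNReal.tsum_mul_left]
      _ ≤ 2 ^ (p - 1) * ((M : ENNReal)⁻¹ * (ENNReal.ofReal Θ * (2 * I)) + c0 * S) := by gcongr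
      _ = (2 ^ (p - 1) * ((M : ENNReal)⁻¹ * (ENNReal.ofReal Θ * 2))) * I + 2 ^ (p - 1) * c0 * S := by
        ring
      _ ≤ _ := by
        gcongr
        refine le_trans (le_of_eq ?_) (ENNReal.ofReal_le_ofReal hMε)
        have t1 : (2 : ENNReal) ^ (p - 1) = ENNReal.ofReal (2 ^ (p - 1)) := by
          rw [← ENNReal.ofReal_rpow_of_pos (by norm_num)]; simp
        have t2 : (M : ENNReal)⁻¹ = ENNReal.ofReal ((M : ℝ)⁻¹) := by
          rw [ENNReal.ofReal_inv_of_pos (by linarith)]; simp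
        have t3 : (2 : ENNReal) = ENNReal.ofReal 2 := by simp
        rw [t1, t2]
        rw [t3]
        rw [← ENNReal.ofReal_mul (by positivity), ← ENNReal.ofReal_mul (by positivity),
          ← ENNReal.ofReal_mul (by positivity)]
        congr 1
        have : (4 * (M : ℝ) * K) ^ σ = (4 * K) ^ σ * M ^ σ := by
          rw [← Real.mul_rpow (by positivity) (by positivity)]; ring_nf
        rw [hΘ, this]
        ring
  have hfar : ∫⁻ x in {x | x ∈ Ω ∧ η0 / K ≤ δ x}, g x * W x ≤ C1 * ∫⁻ x in Ω, g x := by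
    rw [← lintegral_const_mul _ hgm]
    refine (setLIntegral_mono' (hΩ.measurableSet.inter (measurableSet_le measurable_const hδm))
      fun x hx => ?_).trans (lintegral_mono_set inter_subset_left)
    rw [mul_comm]
    exact mul_le_mul_left (wt_le Ω σ η _ hσ (by positivity) x hx.2) _
  calc _ ≤ _ := lintegral_mono_set hcover
    _ ≤ _ := lintegral_union_le _ _ _
    _ ≤ _ := add_le_add hDsum hfar
    _ ≤ ENNReal.ofReal ε * I + ((2 ^ (p - 1) * c0) * ((∫⁻ x in Ω, g x) + S) +
        C1 * ((∫⁻ x in Ω, g x) + S)) := by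
      rw [add_assoc]
      gcongr
      · exact le_add_self
      · exact le_self_add
    _ = _ := by ring

theorem hardy_reg [Nontrivial E] (Ω : Set E) (hΩ : IsOpen Ω) (hbdd : Bornology.IsBounded Ω)
    (hne : (frontier Ω).Nonempty) (p σ : ℝ) (hp : 1 ≤ p) (hσ : 0 < σ) (hσ1 : σ < 1)
    (hchart : ∀ x0 ∈ frontier Ω, ∃ r > (0 : ℝ), ∃ (h : E → ℝ) (v : E) (K : ℝ), ‖v‖ = 1 ∧ 1 ≤ K ∧
      (∀ (x : E) (t : ℝ), h (x + t • v) = h x + t) ∧ (∀ x y, h x ≤ h y + K * ‖x - y‖) ∧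
      Measurable h ∧ ∀ y ∈ Metric.ball x0 r, (y ∈ Ω ↔ 0 < h y)) :
    ∀ ε : ℝ, 0 < ε → ∃ C : ENNReal, C ≠ ⊤ ∧ ∀ w : E → ℝ, Measurable w → ∀ η : ℝ, 0 < η →
      ∫⁻ x in Ω ∩ closure Ω, ENNReal.ofReal (|w x| ^ p) * wt Ω σ η x ≤
        ENNReal.ofReal ε * (∫⁻ x in Ω, ENNReal.ofReal (|w x| ^ p) * wt Ω σ η x) +
        C * ((∫⁻ x in Ω, ENNReal.ofReal (|w x| ^ p)) + ∫⁻ x in Ω, ∫⁻ y in Ω,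
          ENNReal.ofReal (|w x - w y| ^ p / ‖x - y‖ ^ ((Module.finrank ℝ E : ℝ) + σ))) := by
  have hcomp : IsCompact (closure Ω) := hbdd.isCompact_closure
  refine hcomp.induction_on (p := fun t => ∀ ε : ℝ, 0 < ε → ∃ C : ENNReal, C ≠ ⊤ ∧
    ∀ w : E → ℝ, Measurable w → ∀ η : ℝ, 0 < η →
      ∫⁻ x in Ω ∩ t, ENNReal.ofReal (|w x| ^ p) * wt Ω σ η x ≤
        ENNReal.ofReal ε * (∫⁻ x in Ω, ENNReal.ofReal (|w x| ^ p) * wt Ω σ η x) +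
        C * ((∫⁻ x in Ω, ENNReal.ofReal (|w x| ^ p)) + ∫⁻ x in Ω, ∫⁻ y in Ω,
          ENNReal.ofReal (|w x - w y| ^ p / ‖x - y‖ ^ ((Module.finrank ℝ E : ℝ) + σ))))
      ?_ ?_ ?_ ?_
  · intro ε _
    exact ⟨0, by simp, fun w _ η _ => by simp⟩
  · intro t u htu hu ε hε
    obtain ⟨C, hC, H⟩ := hu ε hε
    exact ⟨C, hC, fun w hw η hη =>
      (lintegral_mono_set (inter_subset_inter_right _ htu)).trans (H w hw η hη)⟩
  · intro t u ht hu ε hε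
    obtain ⟨C1, hC1, H1⟩ := ht (ε / 2) (by positivity)
    obtain ⟨C2, hC2, H2⟩ := hu (ε / 2) (by positivity)
    refine ⟨C1 + C2, ENNReal.add_ne_top.mpr ⟨hC1, hC2⟩, fun w hw η hη => ?_⟩
    rw [inter_union_distrib_left]
    refine (lintegral_union_le _ _ _).trans
      ((add_le_add (H1 w hw η hη) (H2 w hw η hη)).trans (le_of_eq ?_))
    have : ENNReal.ofReal ε = ENNReal.ofReal (ε / 2) + ENNReal.ofReal (ε / 2) := by
      rw [← ENNReal.ofReal_add (by positivity) (by positivity)]; ring_nf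
    rw [this]
    ring
  · intro x hx
    by_cases hxf : x ∈ frontier Ω
    · obtain ⟨r, hr, h, v, K, hv, hK, hshift, hLip, hm, hmem⟩ := hchart x hxf
      refine ⟨Metric.ball x (r / 4), mem_nhdsWithin_of_mem_nhds
        (Metric.ball_mem_nhds _ (by positivity)), fun ε hε => ?_⟩
      exact local_bd Ω hΩ hne p σ hp hσ hσ1 x r hr h v hv K hK hshift hLip hm hmem ε hε
    · have hpos : 0 < Metric.infDist x (frontier Ω) :=
        (isClosed_frontier.notMem_iff_infDist_pos hne).mp hxf
      set a := Metric.infDist x (frontier Ω) / 2 with ha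
      have hapos : 0 < a := by positivity
      refine ⟨{y | a < Metric.infDist y (frontier Ω)}, mem_nhdsWithin_of_mem_nhds
        ((isOpen_lt continuous_const (Metric.continuous_infDist_pt _)).mem_nhds
          (by show a < _; rw [ha]; linarith)), fun ε hε => ?_⟩
      refine ⟨ENNReal.ofReal (a ^ (-σ)), ENNReal.ofReal_ne_top, fun w hw η hη => ?_⟩
      refine le_trans ?_ le_add_self
      refine le_trans ?_ (mul_le_mul_right le_self_add _)
      rw [← lintegral_const_mul _ (by fun_prop)]
      refine (setLIntegral_mono' (hΩ.measurableSet.inter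
        (isOpen_lt continuous_const (Metric.continuous_infDist_pt _)).measurableSet)
        fun y hy => ?_).trans (lintegral_mono_set inter_subset_left)
      rw [mul_comm]
      exact mul_le_mul_left (wt_le Ω σ η a hσ hapos y (le_of_lt hy.2)) _

theorem hardy [Nontrivial E] (Ω : Set E) (hΩ : IsOpen Ω) (hbdd : Bornology.IsBounded Ω)
    (hne : (frontier Ω).Nonempty) (p σ : ℝ) (hp : 1 ≤ p) (hσ : 0 < σ) (hσ1 : σ < 1)
    (hchart : ∀ x0 ∈ frontier Ω, ∃ r > (0 : ℝ), ∃ (h : E → ℝ) (v : E) (K : ℝ), ‖v‖ = 1 ∧ 1 ≤ K ∧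
      (∀ (x : E) (t : ℝ), h (x + t • v) = h x + t) ∧ (∀ x y, h x ≤ h y + K * ‖x - y‖) ∧
      Measurable h ∧ ∀ y ∈ Metric.ball x0 r, (y ∈ Ω ↔ 0 < h y)) :
    ∃ C' > (0 : ℝ), ∀ w : E → ℝ, Measurable w →
      ∫⁻ x in Ω, ENNReal.ofReal (|w x| ^ p / Metric.infDist x (frontier Ω) ^ σ) ≤
        ENNReal.ofReal C' * ((∫⁻ x in Ω, ENNReal.ofReal (|w x| ^ p)) + ∫⁻ x in Ω, ∫⁻ y in Ω,
          ENNReal.ofReal (|w x - w y| ^ p / ‖x - y‖ ^ ((Module.finrank ℝ E : ℝ) + σ))) := by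
  obtain ⟨C, hC, H⟩ := hardy_reg Ω hΩ hbdd hne p σ hp hσ hσ1 hchart (1 / 2) (by norm_num)
  refine ⟨2 * C.toReal + 1, by positivity, fun w hw => ?_⟩
  set A := ∫⁻ x in Ω, ENNReal.ofReal (|w x| ^ p) with hA
  set S := ∫⁻ x in Ω, ∫⁻ y in Ω,
          ENNReal.ofReal (|w x - w y| ^ p / ‖x - y‖ ^ ((Module.finrank ℝ E : ℝ) + σ))
  by_cases hAt : A = ⊤
  · rw [hAt, top_add, ENNReal.mul_top]
    · exact le_top
    · exact (ENNReal.ofReal_pos.mpr (by positivity)).ne'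
  have key : ∀ η : ℝ, 0 < η → ∫⁻ x in Ω, ENNReal.ofReal (|w x| ^ p) * wt Ω σ η x ≤
      ENNReal.ofReal (2 * C.toReal + 1) * (A + S) := by
    intro η hη
    have h1 := H w hw η hη
    rw [inter_eq_left.mpr subset_closure] at h1
    set I := ∫⁻ x in Ω, ENNReal.ofReal (|w x| ^ p) * wt Ω σ η x with hI
    have hIt : I ≠ ⊤ := by
      have : I ≤ ENNReal.ofReal (η ^ (-σ)) * A := by
        rw [hA, ← lintegral_const_mul _ (by fun_prop)]
        refine lintegral_mono fun x => ?_
        rw [mul_comm]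
        refine mul_le_mul_left ?_ _
        apply ENNReal.ofReal_le_ofReal
        exact Real.rpow_le_rpow_of_nonpos hη (le_max_right _ _) (by linarith)
      exact ne_top_of_le_ne_top (ENNReal.mul_ne_top ENNReal.ofReal_ne_top hAt) this
    have h2 : ENNReal.ofReal (2 * C.toReal + 1) = 2 * C + 1 := by
      rw [ENNReal.ofReal_add (by positivity) (by norm_num), ENNReal.ofReal_mul (by norm_num),
        ENNReal.ofReal_toReal hC]
      simp
    rw [h2]
    by_cases hSt : C * (A + S) = ⊤
    · have : A + S = ⊤ := by
        by_contra hcon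
        exact ENNReal.mul_ne_top hC hcon hSt
      rw [this, ENNReal.mul_top (by simp)]
      exact le_top
    · have h3 : I.toReal ≤ 1 / 2 * I.toReal + (C * (A + S)).toReal := by
        have := ENNReal.toReal_mono (ENNReal.add_ne_top.mpr
          ⟨ENNReal.mul_ne_top ENNReal.ofReal_ne_top hIt, hSt⟩) h1
        rwa [ENNReal.toReal_add (ENNReal.mul_ne_top ENNReal.ofReal_ne_top hIt) hSt,
          ENNReal.toReal_mul, ENNReal.toReal_ofReal (by norm_num)] at this
      have h4 : I ≤ 2 * (C * (A + S)) := by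
        rw [← ENNReal.toReal_le_toReal hIt (ENNReal.mul_ne_top (by simp) hSt), ENNReal.toReal_mul]
        simp only [ENNReal.toReal_ofNat]
        linarith
      refine h4.trans ?_
      rw [← mul_assoc]
      exact mul_le_mul_left le_self_add _
  set f : ℕ → E → ENNReal := fun n x =>
    ENNReal.ofReal (|w x| ^ p) * wt Ω σ (1 / ((n : ℝ) + 1)) x with hf
  have hfm : ∀ n, Measurable (f n) := fun n =>
    Measurable.mul (by fun_prop) (wt_measurable _ _ _)
  have hmono : Monotone f := by
    intro m n hmn x
    refine mul_le_mul_right ?_ _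
    apply ENNReal.ofReal_le_ofReal
    apply Real.rpow_le_rpow_of_nonpos _ _ (by linarith)
    · exact lt_of_lt_of_le (by positivity) (le_max_right _ _)
    · apply max_le_max_left
      have : (m : ℝ) ≤ n := by exact_mod_cast hmn
      gcongr
  calc _ ≤ ∫⁻ x in Ω, ⨆ n, f n x := by
        refine setLIntegral_mono' hΩ.measurableSet fun x hx => ?_
        have hxf : x ∉ frontier Ω := fun hc => by
          have := hΩ.inter_frontier_eq
          exact (this ▸ (⟨hx, hc⟩ : x ∈ Ω ∩ frontier Ω) : x ∈ (∅ : Set E))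
        have hpos : 0 < Metric.infDist x (frontier Ω) :=
          (isClosed_frontier.notMem_iff_infDist_pos hne).mp hxf
        obtain ⟨n, hn⟩ := exists_nat_one_div_lt hpos
        refine le_trans (le_of_eq ?_) (le_iSup (fun n => f n x) n)
        simp only [hf, wt]
        rw [max_eq_left hn.le, ← ENNReal.ofReal_mul (by positivity), Real.rpow_neg hpos.le,
          div_eq_mul_inv]
    _ = ⨆ n, ∫⁻ x in Ω, f n x := lintegral_iSup hfm hmono
    _ ≤ _ := iSup_le fun n => key _ (by positivity)

theorem first_ineq (Ω : Set E) (hΩ : IsOpen Ω) (hne : (frontier Ω).Nonempty)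
    (p σ : ℝ) (hσ : 0 < σ) :
    ∃ C > (0 : ℝ), ∀ w : E → ℝ, Measurable w →
      ∫⁻ x in Ω, ∫⁻ y in Ωᶜ,
          ENNReal.ofReal (|w x| ^ p / ‖x - y‖ ^ ((Module.finrank ℝ E : ℝ) + σ)) ≤
      ENNReal.ofReal C *
        ∫⁻ x in Ω, ENNReal.ofReal (|w x| ^ p / Metric.infDist x (frontier Ω) ^ σ) := by
  set n := Module.finrank ℝ E with hn
  set T := ∫⁻ z : E, ENNReal.ofReal ((1 + ‖z‖) ^ (-((n : ℝ) + σ))) with hT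
  have hTt : T ≠ ⊤ := (finite_integral_one_add_norm (by rw [← hn]; linarith)).ne
  refine ⟨2 ^ ((n : ℝ) + σ) * (T.toReal + 1), by positivity, fun w hw => ?_⟩
  rw [← lintegral_const_mul' _ _ ENNReal.ofReal_ne_top]
  refine setLIntegral_mono' hΩ.measurableSet fun x hx => ?_
  have hxf : x ∉ frontier Ω := fun hc => by
    have := hΩ.inter_frontier_eq
    exact (this ▸ (⟨hx, hc⟩ : x ∈ Ω ∩ frontier Ω) : x ∈ (∅ : Set E))
  have hpos : 0 < Metric.infDist x (frontier Ω) :=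
    (isClosed_frontier.notMem_iff_infDist_pos hne).mp hxf
  have htail := tail_bound ((n : ℝ) + σ) (by positivity) x _ hpos Ωᶜ hΩ.measurableSet.compl
    (fun y hy => by rw [← dist_eq_norm]; exact infDist_frontier_le hx hy)
  have e : ∀ y, ENNReal.ofReal (|w x| ^ p / ‖x - y‖ ^ ((n : ℝ) + σ)) =
      ENNReal.ofReal (|w x| ^ p) * ENNReal.ofReal (‖x - y‖ ^ (-((n : ℝ) + σ))) := by
    intro y
    rw [← ENNReal.ofReal_mul (by positivity), Real.rpow_neg (norm_nonneg _), div_eq_mul_inv]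
  simp_rw [e]
  rw [lintegral_const_mul' _ _ ENNReal.ofReal_ne_top]
  refine (mul_le_mul_right htail _).trans ?_
  rw [← hn, ← hT, ← ENNReal.ofReal_toReal hTt, ← ENNReal.ofReal_mul (by positivity),
    ← ENNReal.ofReal_mul (by positivity), ← ENNReal.ofReal_mul (by positivity)]
  apply ENNReal.ofReal_le_ofReal
  rw [ENNReal.toReal_ofReal ENNReal.toReal_nonneg]
  have : (n : ℝ) - (n + σ) = -σ := by ring
  rw [this, Real.rpow_neg hpos.le, div_eq_mul_inv]
  have q : 0 ≤ 2 ^ ((n : ℝ) + σ) * (|w x| ^ p * (Metric.infDist x (frontier Ω) ^ σ)⁻¹) := by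
    positivity
  linarith

end Helpers

theorem stmt15 (d : ℕ) (hd : 1 ≤ d) (s p : ℝ) (hs : s ∈ Set.Ioo (0:ℝ) (1/2))
    (hp : 1 ≤ p) (hsp : s * p < 1)
    (Ω : Set (EuclideanSpace ℝ (Fin d))) (hΩ : IsBddLipschitzDomain Ω) :
    ∃ C > (0:ℝ), ∃ C' > (0:ℝ),
      ∀ w : EuclideanSpace ℝ (Fin d) → ℝ, Measurable w → (∀ x ∉ Ω, w x = 0) →
        (∫⁻ q in Ω ×ˢ Ωᶜ, ENNReal.ofReal (|w q.1| ^ p / ‖q.1 - q.2‖ ^ ((d:ℝ) + s*p)))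
          ≤ ENNReal.ofReal C *
            ∫⁻ x in Ω, ENNReal.ofReal (|w x| ^ p / Metric.infDist x (frontier Ω) ^ (s*p)) ∧
        (∫⁻ x in Ω, ENNReal.ofReal (|w x| ^ p / Metric.infDist x (frontier Ω) ^ (s*p)))
          ≤ ENNReal.ofReal C' *
            ((∫⁻ x in Ω, ENNReal.ofReal (|w x| ^ p)) +
              ∫⁻ q in Ω ×ˢ Ω, ENNReal.ofReal (|w q.1 - w q.2| ^ p / ‖q.1 - q.2‖ ^ ((d:ℝ) + s*p))) := by
  obtain ⟨hopen, hbdd, hnon, hch⟩ := hΩ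
  have hσ : 0 < s * p := mul_pos hs.1 (by linarith)
  have : Nonempty (Fin d) := ⟨⟨0, hd⟩⟩
  have : Nontrivial (EuclideanSpace ℝ (Fin d)) := inferInstance
  have hne : (frontier Ω).Nonempty := by
    refine nonempty_frontier_iff.mpr ⟨hnon, fun hc => ?_⟩
    exact NormedSpace.unbounded_univ ℝ (EuclideanSpace ℝ (Fin d)) (hc ▸ hbdd)
  obtain ⟨C, hC, H1⟩ := first_ineq Ω hopen hne p (s * p) hσ
  obtain ⟨C', hC', H2⟩ := hardy Ω hopen hbdd hne p (s * p) hp hσ hsp (by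
    intro x0 hx0
    obtain ⟨r, hr, v, hv, L, f, hf, hinv, hmem⟩ := hch x0 hx0
    refine ⟨r, hr, fun y => ⟪y, v⟫ - f y, v, 1 + L, hv, by simp, ?_, ?_, ?_, ?_⟩
    · intro x t
      simp only [hinv, inner_add_left, inner_smul_left, real_inner_self_eq_norm_sq, hv]
      simp
      ring
    · intro x y
      have h1 := hf.dist_le_mul y x
      rw [Real.dist_eq, dist_comm, dist_eq_norm] at h1
      have h2 := le_abs_self (f y - f x)
      have h3 := real_inner_le_norm (x - y) v
      rw [inner_sub_left, hv] at h3
      linarith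
    · exact (Continuous.sub (by fun_prop) hf.continuous).measurable
    · intro y hy
      rw [hmem y hy, sub_pos])
  refine ⟨C, hC, C', hC', fun w hw _ => ⟨?_, ?_⟩⟩
  · have := H1 w hw
    rw [finrank_euclideanSpace_fin] at this
    rw [Measure.volume_eq_prod, setLIntegral_prod _ (by fun_prop)]
    exact this
  · have := H2 w hw
    rw [finrank_euclideanSpace_fin] at this
    rw [Measure.volume_eq_prod, setLIntegral_prod _ (by fun_prop)]
    exact this
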